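/- arXiv:1902.03552 — 2 statements merged into one kernel-verified Lean document; each statement's English description precedes it below -/
import Mathlib

section
/- The optimal sampling threshold is strictly increasing in β: if mse_Y ≤ β₁ < β₂ < mse_∞ and v₁ ≥ 0, v₂ ≥ 0 satisfy (mse_∞ − β₁)·G((√θ/σ)·v₁) = mse_∞ − mse_Y and (mse_∞ − β₂)·G((√θ/σ)·v₂) = mse_∞ − mse_Y, then v₁ < v₂. -/
open Real MeasureTheory Filter Set

/-- `G x = (e^{x²}/x) ∫_0^x e^{-t²} dt` for `x ≠ 0`, and `G 0 = 1`. -/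
noncomputable def G (x : ℝ) : ℝ :=
  if x = 0 then 1 else (Real.exp (x ^ 2) / x) * ∫ t in (0:ℝ)..x, Real.exp (-t ^ 2)

/-- `mse_∞ = σ²/(2θ)`. -/
noncomputable def mseInf (θ σ : ℝ) : ℝ := σ ^ 2 / (2 * θ)

/-- `mse_Y = (σ²/(2θ)) ∫ (1 - e^{-2θy}) dμ(y)`. -/
noncomputable def mseY (θ σ : ℝ) (μ : Measure ℝ) : ℝ :=
  σ ^ 2 / (2 * θ) * ∫ y, (1 - Real.exp (-(2 * θ * y))) ∂μ

theorem G_eq_integral (x : ℝ) :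
    G x = ∫ s in (0:ℝ)..1, Real.exp (x ^ 2 * (1 - s ^ 2)) := by
  unfold G
  split_ifs with h
  · simp [h]
  · have h1 := intervalIntegral.mul_integral_comp_mul_left (a := 0) (b := 1)
      (f := fun t : ℝ => Real.exp (-t ^ 2)) x
    simp only [mul_zero, mul_one] at h1
    rw [← h1, ← mul_assoc, div_mul_cancel₀ _ h, ← intervalIntegral.integral_const_mul]
    congr 1
    ext s
    rw [← Real.exp_add]
    congr 1
    ring

theorem G_mono {x y : ℝ} (hx : 0 ≤ x) (hxy : x ≤ y) : G x ≤ G y := by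
  rw [G_eq_integral, G_eq_integral]
  apply intervalIntegral.integral_mono_on zero_le_one
  · exact Continuous.intervalIntegrable (by fun_prop) _ _
  · exact Continuous.intervalIntegrable (by fun_prop) _ _
  · intro s hs
    have h1 : 0 ≤ 1 - s ^ 2 := by nlinarith [hs.1, hs.2]
    have h2 : x ^ 2 ≤ y ^ 2 := by gcongr
    exact Real.exp_le_exp.mpr (mul_le_mul_of_nonneg_right h2 h1)

/-- The optimal sampling threshold is strictly increasing in `β`. -/
theorem threshold_strictMono (θ σ : ℝ) (hθ : 0 < θ) (hσ : 0 < σ)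
    (μ : Measure ℝ) [IsProbabilityMeasure μ] (hsupp : ∀ᵐ y ∂μ, 0 ≤ y)
    (hint : Integrable (fun y : ℝ => y) μ) (hmean : 0 < ∫ y, y ∂μ)
    (β₁ β₂ v₁ v₂ : ℝ)
    (hβ₁ : mseY θ σ μ ≤ β₁) (hβ₁₂ : β₁ < β₂) (hβ₂ : β₂ < mseInf θ σ)
    (hv₁ : 0 ≤ v₁) (hv₂ : 0 ≤ v₂)
    (heq₁ : (mseInf θ σ - β₁) * G (Real.sqrt θ / σ * v₁) = mseInf θ σ - mseY θ σ μ)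
    (heq₂ : (mseInf θ σ - β₂) * G (Real.sqrt θ / σ * v₂) = mseInf θ σ - mseY θ σ μ) :
    v₁ < v₂ := by
  by_contra hlt
  have hle : v₂ ≤ v₁ := not_lt.mp hlt
  have ha : 0 ≤ Real.sqrt θ / σ := by positivity
  have hG := G_mono (mul_nonneg ha hv₂) (mul_le_mul_of_nonneg_left hle ha)
  have h1 : 0 < mseInf θ σ - β₁ := by linarith
  have h2 : 0 < (mseInf θ σ - β₁) * G (Real.sqrt θ / σ * v₁) := by rw [heq₁]; linarith
  have h3 : 0 < G (Real.sqrt θ / σ * v₁) := (mul_pos_iff_of_pos_left h1).mp h2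
  have h4 := mul_le_mul_of_nonneg_left hG (sub_pos.mpr hβ₂).le
  nlinarith [mul_pos (sub_pos.mpr hβ₁₂) h3]
end

section
/- Wiener limit of the optimal threshold: let β > ∫ y dμ(y), and suppose v : ℝ → ℝ and δ > 0 are such that for every θ ∈ (0, δ), v(θ) ≥ 0 and (1 − 2θβ)·G(√θ·v(θ)) = ∫ e^{−2θy} dμ(y). Then v(θ) → √(3·(β − ∫ y dμ(y))) as θ → 0 from the right. -/
open Real MeasureTheory Filter Set

lemma G_aux_deriv (C x : ℝ) :
    HasDerivAt (fun x : ℝ => (x + 2 / 3 * x ^ 3 + C * x ^ 5) * Real.exp (-x ^ 2))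
      ((1 + (5 * C - 4 / 3) * x ^ 4 - 2 * C * x ^ 6) * Real.exp (-x ^ 2)) x := by
  have h1 : HasDerivAt (fun x : ℝ => x + 2 / 3 * x ^ 3 + C * x ^ 5)
      (1 + 2 / 3 * (3 * x ^ 2) + C * (5 * x ^ 4)) x := by
    have h3 := (hasDerivAt_pow 3 x).const_mul (2 / 3 : ℝ)
    have h5 := (hasDerivAt_pow 5 x).const_mul C
    have := ((hasDerivAt_id x).add h3).add h5
    norm_num at this
    exact this
  have h2 : HasDerivAt (fun x : ℝ => Real.exp (-x ^ 2)) (Real.exp (-x ^ 2) * (-(2 * x))) x := by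
    have := ((hasDerivAt_pow 2 x).neg).exp
    norm_num at this
    simpa using this
  exact (h1.mul h2).congr_deriv (by ring)

lemma G_aux_int (C x : ℝ) :
    ∫ t in (0:ℝ)..x, ((1 + (5 * C - 4 / 3) * t ^ 4 - 2 * C * t ^ 6) * Real.exp (-t ^ 2)) =
      (x + 2 / 3 * x ^ 3 + C * x ^ 5) * Real.exp (-x ^ 2) := by
  rw [intervalIntegral.integral_eq_sub_of_hasDerivAt (fun t _ => G_aux_deriv C t)]
  · simp
  · exact Continuous.intervalIntegrable (by fun_prop) _ _

lemma G_eq {x : ℝ} (hx : 0 < x) (p : ℝ) :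
    1 + p = (Real.exp (x ^ 2) / x) * ((x * (1 + p)) * Real.exp (-x ^ 2)) := by
  rw [Real.exp_neg]
  field_simp

lemma G_lower {x : ℝ} (hx : 0 ≤ x) : 1 + 2 / 3 * x ^ 2 ≤ G x := by
  rcases hx.eq_or_lt with rfl | hx
  · simp [G]
  rw [G, if_neg hx.ne', G_eq hx]
  refine mul_le_mul_of_nonneg_left ?_ (by positivity)
  have h := G_aux_int 0 x
  have e : x * (1 + 2 / 3 * x ^ 2) = x + 2 / 3 * x ^ 3 + 0 * x ^ 5 := by ring
  rw [e, ← h]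
  refine intervalIntegral.integral_mono_on hx.le
    (Continuous.intervalIntegrable (by fun_prop) _ _)
    (Continuous.intervalIntegrable (by fun_prop) _ _) ?_
  intro t ht
  have : 0 ≤ t ^ 4 := by positivity
  have h3 := Real.exp_pos (-t ^ 2)
  nlinarith

lemma G_upper {x : ℝ} (hx : 0 ≤ x) (hx1 : x ≤ 1) : G x ≤ 1 + (2 / 3 * x ^ 2 + x ^ 4) := by
  rcases hx.eq_or_lt with rfl | hx
  · simp [G]
  rw [G, if_neg hx.ne', G_eq hx]
  refine mul_le_mul_of_nonneg_left ?_ (by positivity)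
  have h := G_aux_int 1 x
  have e : x * (1 + (2 / 3 * x ^ 2 + x ^ 4)) = x + 2 / 3 * x ^ 3 + 1 * x ^ 5 := by ring
  rw [e, ← h]
  refine intervalIntegral.integral_mono_on hx.le
    (Continuous.intervalIntegrable (by fun_prop) _ _)
    (Continuous.intervalIntegrable (by fun_prop) _ _) ?_
  intro t ht
  have h4 : 0 ≤ t ^ 4 := by positivity
  have ht2 : t ^ 2 ≤ 1 := by nlinarith [ht.1, ht.2]
  have h6 : t ^ 6 ≤ t ^ 4 := by nlinarith
  have h3 := Real.exp_pos (-t ^ 2)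
  nlinarith

lemma laplace_lim (μ : Measure ℝ) [IsProbabilityMeasure μ] (hsupp : ∀ᵐ y ∂μ, 0 ≤ y)
    (hint : Integrable (fun y : ℝ => y) μ) :
    Tendsto (fun θ : ℝ => (1 - ∫ y, Real.exp (-(2 * θ * y)) ∂μ) / θ)
      (nhdsWithin 0 (Ioi 0)) (nhds (2 * ∫ y, y ∂μ)) := by
  have key : Tendsto (fun θ : ℝ => ∫ y, (1 - Real.exp (-(2 * θ * y))) / θ ∂μ)
      (nhdsWithin 0 (Ioi 0)) (nhds (∫ y, 2 * y ∂μ)) := by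
    refine tendsto_integral_filter_of_dominated_convergence (fun y => 2 * y) ?_ ?_
      (hint.const_mul 2) ?_
    · filter_upwards with θ
      exact Continuous.aestronglyMeasurable (by fun_prop)
    · filter_upwards [self_mem_nhdsWithin] with θ hθ
      have hθ : 0 < θ := hθ
      filter_upwards [hsupp] with y hy
      have h1 : Real.exp (-(2 * θ * y)) ≤ 1 := by
        rw [Real.exp_le_one_iff]
        have : 0 ≤ 2 * θ * y := by positivity
        linarith
      have h2 := Real.add_one_le_exp (-(2 * θ * y))
      rw [Real.norm_of_nonneg (div_nonneg (by linarith) hθ.le), div_le_iff₀ hθ]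
      linarith
    · filter_upwards with y
      have hd : HasDerivAt (fun θ : ℝ => 1 - Real.exp (-(2 * θ * y))) (2 * y) 0 := by
        have h0 : HasDerivAt (fun θ : ℝ => -(2 * θ * y)) (-(2 * 1 * y)) 0 :=
          (((hasDerivAt_id (0:ℝ)).const_mul 2).mul_const y).neg
        have := h0.exp.const_sub 1
        exact this.congr_deriv (by simp)
      have := hd.tendsto_slope.mono_left
        (nhdsWithin_mono (0:ℝ) (show Ioi (0:ℝ) ⊆ {0}ᶜ from fun x hx => ne_of_gt hx))
      refine this.congr (fun θ => ?_)
      simp [slope_def_field]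
  rw [integral_const_mul] at key
  refine key.congr' ?_
  filter_upwards [self_mem_nhdsWithin] with θ hθ
  have hθ : 0 < θ := hθ
  rw [integral_div, integral_sub (integrable_const _), integral_const]
  · simp
  · refine Integrable.mono' (integrable_const (1:ℝ))
      (Continuous.aestronglyMeasurable (by fun_prop)) ?_
    filter_upwards [hsupp] with y hy
    rw [Real.norm_of_nonneg (Real.exp_pos _).le, Real.exp_le_one_iff]
    have : 0 ≤ 2 * θ * y := by positivity
    linarith

/-- Wiener limit of the optimal threshold:
if for every `θ ∈ (0, δ)` we have `v θ ≥ 0` and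
`(1 - 2θβ) G(√θ v θ) = ∫ e^{-2θy} dμ(y)`, then
`v θ → √(3 (β - ∫ y dμ))` as `θ → 0⁺`. -/
theorem wiener_limit_of_threshold
    (μ : Measure ℝ) [IsProbabilityMeasure μ] (hsupp : ∀ᵐ y ∂μ, 0 ≤ y)
    (hint : Integrable (fun y : ℝ => y) μ) (hmean : 0 < ∫ y, y ∂μ)
    (β : ℝ) (hβ : (∫ y, y ∂μ) < β)
    (v : ℝ → ℝ) (δ : ℝ) (hδ : 0 < δ)
    (hv : ∀ θ ∈ Ioo (0:ℝ) δ, 0 ≤ v θ ∧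
      (1 - 2 * θ * β) * G (Real.sqrt θ * v θ) = ∫ y, Real.exp (-(2 * θ * y)) ∂μ) :
    Tendsto v (nhdsWithin 0 (Ioi 0)) (nhds (Real.sqrt (3 * (β - ∫ y, y ∂μ)))) := by
  set m := ∫ y, y ∂μ with hm
  set q : ℝ → ℝ := fun θ =>
    (2 * β - (1 - ∫ y, Real.exp (-(2 * θ * y)) ∂μ) / θ) / (1 - 2 * θ * β) with hq
  have hid : Tendsto (fun θ : ℝ => θ) (nhdsWithin 0 (Ioi 0)) (nhds 0) :=
    tendsto_id.mono_left nhdsWithin_le_nhds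
  have hden : Tendsto (fun θ : ℝ => 1 - 2 * θ * β) (nhdsWithin 0 (Ioi 0)) (nhds 1) := by
    have := ((hid.const_mul 2).mul_const β).const_sub 1
    simpa using this
  have hqlim : Tendsto q (nhdsWithin 0 (Ioi 0)) (nhds (2 * (β - m))) := by
    have := ((laplace_lim μ hsupp hint).const_sub (2 * β)).div hden one_ne_zero
    rw [div_one, ← mul_sub] at this
    exact this
  have hθq : Tendsto (fun θ => 3 / 2 * (θ * q θ)) (nhdsWithin 0 (Ioi 0)) (nhds 0) := by
    have := (hid.mul hqlim).const_mul (3 / 2)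
    simpa using this
  have hup : Tendsto (fun θ => 3 / 2 * q θ) (nhdsWithin 0 (Ioi 0)) (nhds (3 * (β - m))) := by
    have := hqlim.const_mul (3 / 2)
    convert this using 2
    ring
  have hlo : Tendsto (fun θ => q θ / (2 / 3 + 3 / 2 * (θ * q θ))) (nhdsWithin 0 (Ioi 0))
      (nhds (3 * (β - m))) := by
    have := hqlim.div (hθq.const_add (2 / 3)) (by norm_num)
    have e : 2 * (β - m) / (2 / 3 + 0) = 3 * (β - m) := by ring
    rw [e] at this
    exact this
  have hbounds : ∀ᶠ θ in nhdsWithin (0:ℝ) (Ioi 0), 0 ≤ v θ ∧ v θ ^ 2 ≤ 3 / 2 * q θ ∧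
      q θ / (2 / 3 + 3 / 2 * (θ * q θ)) ≤ v θ ^ 2 := by
    filter_upwards [self_mem_nhdsWithin, Ioo_mem_nhdsGT hδ,
      hden.eventually (lt_mem_nhds one_pos), hθq.eventually (gt_mem_nhds one_pos)]
      with θ hθ hθδ hd h1
    have hθ : 0 < θ := hθ
    obtain ⟨hv0, hG⟩ := hv θ hθδ
    have hu0 : 0 ≤ Real.sqrt θ * v θ := by positivity
    have hu2 : (Real.sqrt θ * v θ) ^ 2 = θ * v θ ^ 2 := by
      rw [mul_pow, Real.sq_sqrt hθ.le]
    have hGq : G (Real.sqrt θ * v θ) = 1 + θ * q θ := by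
      have : G (Real.sqrt θ * v θ) = (∫ y, Real.exp (-(2 * θ * y)) ∂μ) / (1 - 2 * θ * β) := by
        rw [eq_div_iff hd.ne', ← hG]; ring
      rw [this, hq]
      have hd' := hd.ne'
      simp only
      generalize (∫ y, Real.exp (-(2 * θ * y)) ∂μ) = L
      rw [div_eq_iff hd', add_mul, mul_assoc θ, div_mul_cancel₀ _ hd', mul_sub θ,
        mul_div_cancel₀ _ hθ.ne']
      ring
    have hl := G_lower hu0
    rw [hGq, hu2] at hl
    have hvq : v θ ^ 2 ≤ 3 / 2 * q θ := by
      have : θ * (2 / 3 * v θ ^ 2) ≤ θ * q θ := by linarith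
      have := le_of_mul_le_mul_left this hθ
      linarith
    have hw : θ * v θ ^ 2 ≤ 3 / 2 * (θ * q θ) := by linarith
    have hu1 : Real.sqrt θ * v θ ≤ 1 := by
      nlinarith
    have hr := G_upper hu0 hu1
    have h4 : (Real.sqrt θ * v θ) ^ 4 = (θ * v θ ^ 2) ^ 2 := by rw [← hu2]; ring
    rw [hGq, h4, hu2] at hr
    have hq2 : q θ ≤ v θ ^ 2 * (2 / 3 + θ * v θ ^ 2) := by
      have : θ * q θ ≤ θ * (v θ ^ 2 * (2 / 3 + θ * v θ ^ 2)) := by linarith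
      exact le_of_mul_le_mul_left this hθ
    have hp : 0 ≤ θ * v θ ^ 2 := by positivity
    refine ⟨hv0, hvq, ?_⟩
    rw [div_le_iff₀ (by linarith)]
    refine hq2.trans (mul_le_mul_of_nonneg_left (by linarith) (sq_nonneg _))
  have hsq : Tendsto (fun θ => v θ ^ 2) (nhdsWithin 0 (Ioi 0)) (nhds (3 * (β - m))) :=
    tendsto_of_tendsto_of_tendsto_of_le_of_le' hlo hup
      (hbounds.mono fun _ h => h.2.2) (hbounds.mono fun _ h => h.2.1)
  exact hsq.sqrt.congr' (hbounds.mono fun θ h => Real.sqrt_sq h.1)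
end
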